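/- arXiv:1505.07889 — 5 statements merged into one kernel-verified Lean document; each statement's English description precedes it below -/
import Mathlib

section
/- (Interpolation for difference quotients.) Let α, β ∈ (0,1) with α + β < 1. There exists a constant C > 0, depending only on 1 − (α+β), such that for every continuous u : [−1,0] → ℝ, sup_{τ∈(0,1)} |u(0) − u(−τ)| / τ^{α+β} ≤ C ( osc_{[−1,0]} u + sup_{τ∈(0,1)} [δ_τ u / τ^β]_{C^{0,α}_*([−1+τ,0])} ). -/
open Set

/-- If `|2 D(τ) - D(2τ)| ≤ K τ^γ` at small scales with `γ < 1` and `|D| ≤ K` at scales in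
`(1/2, 1]`, then `|D(τ)| ≤ C K τ^γ` for all `τ ∈ (0, 1]`. -/
lemma abs_le_rpow_of_dyadic_doubling {D : ℝ → ℝ} {K γ C : ℝ} (hK : 0 ≤ K)
    (hγ1 : γ < 1) (hC2 : 2 ≤ C) (hC : C * (2 ^ γ / 2) + 1 ≤ C)
    (hlarge : ∀ τ ∈ Ioc (1 / 2 : ℝ) 1, |D τ| ≤ K)
    (hdouble : ∀ τ ∈ Ioc (0 : ℝ) (1 / 2), |2 * D τ - D (2 * τ)| ≤ K * τ ^ γ)
    {τ : ℝ} (hτ : τ ∈ Ioc (0 : ℝ) 1) : |D τ| ≤ C * K * τ ^ γ := by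
  have base : ∀ τ ∈ Ioc (1 / 2 : ℝ) 1, |D τ| ≤ C * K * τ ^ γ := by
    intro τ hτ
    have hpow : (1 / 2 : ℝ) ≤ τ ^ γ := by
      have h := Real.rpow_le_rpow_of_exponent_ge (by linarith [hτ.1]) hτ.2 hγ1.le
      rw [Real.rpow_one] at h
      linarith [hτ.1]
    have h1 : 1 ≤ C * τ ^ γ := by nlinarith
    calc |D τ| ≤ K := hlarge τ hτ
      _ ≤ K * (C * τ ^ γ) := le_mul_of_one_le_right hK h1
      _ = C * K * τ ^ γ := by ring
  have key : ∀ n : ℕ, ∀ τ ∈ Ioc (0 : ℝ) 1, (1 / 2 : ℝ) ^ (n + 1) < τ →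
      |D τ| ≤ C * K * τ ^ γ := by
    intro n
    induction n with
    | zero =>
      intro τ hτ h
      exact base τ ⟨by simpa using h, hτ.2⟩
    | succ n ih =>
      intro τ hτ h
      rcases lt_or_ge (1 / 2) τ with h2 | h2
      · exact base τ ⟨h2, hτ.2⟩
      have h3 := ih (2 * τ) ⟨by linarith [hτ.1], by linarith⟩ (by rw [pow_succ] at h; linarith)
      have h4 := hdouble τ ⟨hτ.1, h2⟩
      rw [Real.mul_rpow zero_le_two hτ.1.le] at h3
      have hKp : 0 ≤ K * τ ^ γ := mul_nonneg hK (Real.rpow_nonneg hτ.1.le γ)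
      have h5 : |2 * D τ| ≤ |2 * D τ - D (2 * τ)| + |D (2 * τ)| := by
        simpa using abs_add_le (2 * D τ - D (2 * τ)) (D (2 * τ))
      rw [abs_mul, abs_two] at h5
      have h6 := mul_le_mul_of_nonneg_right hC hKp
      linarith
  obtain ⟨n, hn⟩ := exists_pow_lt_of_lt_one hτ.1 (by norm_num : (1 / 2 : ℝ) < 1)
  refine key n τ hτ (lt_of_le_of_lt ?_ hn)
  exact pow_le_pow_of_le_one (by norm_num) (by norm_num) n.le_succ

/-- **Interpolation for difference quotients** (after Lemma 5.6 of Caffarelli–Cabre):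
for `α + β < 1` there is `C`, depending only on `m = 1 - (α+β)`, with
`sup_{τ∈(0,1)} |u(0)-u(-τ)|/τ^{α+β} ≤ C (osc_{[-1,0]} u + sup_{τ∈(0,1)} [δ_τ u/τ^β]_{C^{0,α}_*([-1+τ,0])})`
for every continuous `u : [-1,0] → ℝ`.  Here `S` is any upper bound for the Hölder
seminorms of the difference quotients. -/
theorem interpolation_difference_quotients (m : ℝ) (hm : 0 < m) :
    ∃ C > 0, ∀ α β : ℝ, α ∈ Ioo (0 : ℝ) 1 → β ∈ Ioo (0 : ℝ) 1 → 1 - (α + β) = m →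
      ∀ u : ℝ → ℝ, ContinuousOn u (Icc (-1 : ℝ) 0) →
      ∀ S : ℝ,
        (∀ τ ∈ Ioo (0 : ℝ) 1, ∀ s ∈ Icc (-1 + τ) (0 : ℝ), ∀ t ∈ Icc (-1 + τ) (0 : ℝ),
          |(u t - u (t - τ)) / τ ^ β - (u s - u (s - τ)) / τ ^ β| ≤ S * |t - s| ^ α) →
      ∀ τ ∈ Ioo (0 : ℝ) 1,
        |u 0 - u (-τ)| / τ ^ (α + β) ≤
          C * ((sSup (u '' Icc (-1 : ℝ) 0) - sInf (u '' Icc (-1 : ℝ) 0)) + S) := by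
  have hr : (2 : ℝ) ^ (1 - m) / 2 < 1 := by
    have h := Real.rpow_lt_rpow_of_exponent_lt one_lt_two (show 1 - m < 1 by linarith)
    rw [Real.rpow_one] at h
    linarith
  have hr0 : (0 : ℝ) < 2 ^ (1 - m) / 2 := by positivity
  set r : ℝ := 2 ^ (1 - m) / 2 with hrdef
  have hCr : 2 / (1 - r) * (1 - r) = 2 := div_mul_cancel₀ _ (by linarith)
  have hCpos : 0 < 2 / (1 - r) := div_pos two_pos (by linarith)
  refine ⟨2 / (1 - r), hCpos, ?_⟩
  intro α β hα hβ hab u hu S hS τ hτ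
  have hγ : α + β = 1 - m := by linarith
  have hS0 : 0 ≤ S := by
    have h := (abs_nonneg _).trans (hS (1 / 2) ⟨by norm_num, by norm_num⟩ (-(1 / 2))
      ⟨by norm_num, by norm_num⟩ 0 ⟨by norm_num, le_rfl⟩)
    exact nonneg_of_mul_nonneg_left h (Real.rpow_pos_of_pos (by norm_num) α)
  have hcomp : IsCompact (u '' Icc (-1 : ℝ) 0) := isCompact_Icc.image_of_continuousOn hu
  have hosc : ∀ τ ∈ Icc (0 : ℝ) 1,
      |u 0 - u (-τ)| ≤ sSup (u '' Icc (-1 : ℝ) 0) - sInf (u '' Icc (-1 : ℝ) 0) := by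
    intro τ hτ
    have h0 : u 0 ∈ u '' Icc (-1 : ℝ) 0 := mem_image_of_mem u ⟨by norm_num, le_rfl⟩
    have h1 : u (-τ) ∈ u '' Icc (-1 : ℝ) 0 :=
      mem_image_of_mem u ⟨by linarith [hτ.2], by linarith [hτ.1]⟩
    have := le_csSup hcomp.bddAbove h0
    have := le_csSup hcomp.bddAbove h1
    have := csInf_le hcomp.bddBelow h0
    have := csInf_le hcomp.bddBelow h1
    rw [abs_le]
    constructor <;> linarith
  have hosc0 := (abs_nonneg _).trans (hosc 0 ⟨le_rfl, zero_le_one⟩)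
  rw [div_le_iff₀ (Real.rpow_pos_of_pos hτ.1 _)]
  refine abs_le_rpow_of_dyadic_doubling (D := fun τ => u 0 - u (-τ)) (by linarith)
    (by linarith) (by nlinarith) ?_ ?_ ?_ ⟨hτ.1, hτ.2.le⟩
  · rw [hγ, ← hrdef]
    linarith
  · intro σ hσ
    linarith [hosc σ ⟨by linarith [hσ.1], hσ.2⟩]
  · intro σ hσ
    have hpos : 0 < σ ^ β := Real.rpow_pos_of_pos hσ.1 β
    have h := hS σ ⟨hσ.1, by linarith [hσ.2]⟩ (-σ) ⟨by linarith [hσ.2], by linarith [hσ.1]⟩ 0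
      ⟨by linarith [hσ.2], le_rfl⟩
    rw [← sub_div, abs_div, abs_of_pos hpos, div_le_iff₀ hpos, zero_sub, zero_sub, neg_neg,
      abs_of_pos hσ.1, mul_assoc, ← Real.rpow_add hσ.1] at h
    have he : 2 * (u 0 - u (-σ)) - (u 0 - u (-(2 * σ))) =
        u 0 - u (-σ) - (u (-σ) - u (-σ - σ)) := by
      rw [show -(2 * σ) = -σ - σ by ring]
      ring
    simp only [he]
    refine h.trans (mul_le_mul_of_nonneg_right (by linarith) (Real.rpow_nonneg hσ.1.le _))
end

section
/- Let α, β ∈ (0,1) with α + β < 1. There exists a constant C > 0, depending only on 1 − (α+β), such that for every continuous u : [−1,0] → ℝ and every τ̄ ∈ (0,1): (i) sup_{τ∈(0,τ̄)} |u(0)−u(−τ)| / τ^{β+α} ≤ |u(0)−u(−τ̄)| / τ̄^{β+α} + C sup_{τ∈(0,1)} [δ_τ u / τ^β]_{C^{0,α}_*([−1+τ,0])}; and (ii) sup_{τ∈(τ̄,1)} |u(0)−u(−τ)| / τ^β ≥ (1/2) sup_{τ∈(0,1)} |u(0)−u(−τ)| / τ^β − C τ̄^α sup_{τ∈(0,1)}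 [δ_τ u / τ^β]_{C^{0,α}_*([−1+τ,0])}. -/
open Set

/-- A continuous function on `[0, T]` which is additive up to an error `E` is within `3 * E` of
the linear function with the same value at `T`. -/
theorem abs_sub_linear_le_of_almost_additive {f : ℝ → ℝ} {T E : ℝ} (hT : 0 < T)
    (hf : ContinuousOn f (Icc 0 T))
    (hadd : ∀ a b : ℝ, 0 ≤ a → 0 ≤ b → a + b ≤ T → |f (a + b) - f a - f b| ≤ E)
    {x : ℝ} (hx : x ∈ Icc 0 T) : |f x - x / T * f T| ≤ 3 * E := by
  set h : ℝ → ℝ := fun y => f y - y / T * f T with hh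
  have hc : ContinuousOn (fun y => |h y|) (Icc 0 T) := by
    have : ContinuousOn (fun y : ℝ => y / T * f T) (Icc 0 T) := by fun_prop
    exact (hf.sub this).abs
  obtain ⟨z, hz, hmax⟩ := isCompact_Icc.exists_isMaxOn ⟨x, hx⟩ hc
  have hmax' : ∀ y ∈ Icc 0 T, |h y| ≤ |h z| := fun y hy => hmax hy
  have hadd' : ∀ a b : ℝ, 0 ≤ a → 0 ≤ b → a + b ≤ T → |h (a + b) - h a - h b| ≤ E := by
    intro a b ha hb hab
    have : h (a + b) - h a - h b = f (a + b) - f a - f b := by simp only [hh]; ring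
    rw [this]
    exact hadd a b ha hb hab
  have hhT : h T = 0 := by simp only [hh]; field_simp; ring
  have half : ∀ y, 0 ≤ y → y + y ≤ T → |h y| ≤ |h z| / 2 + E / 2 := by
    intro y hy hyT
    have h1 := abs_le.1 (hadd' y y hy hy hyT)
    have h2 := abs_le.1 (hmax' (y + y) ⟨by linarith, hyT⟩)
    rw [abs_le]
    constructor <;> linarith [h1.1, h1.2, h2.1, h2.2]
  have hE : 0 ≤ E := (abs_nonneg _).trans (hadd 0 0 le_rfl le_rfl (by linarith))
  have hzE : |h z| ≤ |h z| / 2 + 3 / 2 * E := by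
    rcases le_total (z + z) T with hzT | hzT
    · linarith [half z hz.1 hzT]
    · have h1 := hadd' z (T - z) hz.1 (by linarith [hz.2]) (by linarith)
      rw [add_sub_cancel, hhT] at h1
      have h1 := abs_le.1 h1
      have h2 := abs_le.1 (half (T - z) (by linarith [hz.2]) (by linarith))
      rw [abs_le (b := |h z| / 2 + 3 / 2 * E)]
      constructor <;> linarith [h1.1, h1.2, h2.1, h2.2]
  exact (hmax' x hx).trans (by linarith)

/-- If `f` is continuous on `[0, T]` and `f (a + b) - f a - f b` is bounded by
`S * a ^ α * b ^ β` with `α + β < 1`, then `|f τ| / τ ^ (β + α)` is controlled on `(0, T]` by its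
value at `T`. -/
theorem abs_le_mul_rpow_of_almost_additive {f : ℝ → ℝ} {T S α β : ℝ} (hT : 0 < T)
    (hα : 0 < α) (hβ : 0 < β) (hαβ : α + β < 1) (hS : 0 ≤ S)
    (hf : ContinuousOn f (Icc 0 T))
    (hadd : ∀ a b : ℝ, 0 ≤ a → 0 ≤ b → a + b ≤ T →
      |f (a + b) - f a - f b| ≤ S * a ^ α * b ^ β)
    {τ : ℝ} (hτ : 0 < τ) (hτT : τ ≤ T) :
    |f τ| ≤ (|f T| / T ^ (β + α) + 6 / (1 - (2 : ℝ) ^ (-(1 - (α + β)))) * S) *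
      τ ^ (β + α) := by
  set q : ℝ := (2 : ℝ) ^ (-(1 - (α + β))) with hq
  set G : ℝ := |f T| / T ^ (β + α) with hG
  have hq0 : 0 < q := by positivity
  have hq1 : q < 1 := Real.rpow_lt_one_of_one_lt_of_neg (by norm_num) (by linarith)
  have h2q : (2 : ℝ) ^ (β + α) = 2 * q := by
    rw [hq, show β + α = 1 + -(1 - (α + β)) by ring, Real.rpow_add (by norm_num), Real.rpow_one]
  have hG0 : 0 ≤ G := by positivity
  set D : ℝ := 6 / (1 - q) with hD
  have hDq : D * (1 - q) = 6 := by rw [hD]; field_simp [(sub_pos.2 hq1).ne']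
  have hD6 : 6 ≤ D := by
    rw [hD, le_div_iff₀ (by linarith)]; linarith
  have key : ∀ n : ℕ, ∀ t : ℝ, 0 < t → t ≤ T → T ≤ 2 ^ (n + 1) * t →
      |f t| ≤ (G + D * S) * t ^ (β + α) := by
    intro n
    induction n with
    | zero =>
      intro t ht htT hTt
      have hTt : T ≤ 2 * t := by simpa using hTt
      have hTS : ∀ a b : ℝ, 0 ≤ a → 0 ≤ b → a + b ≤ T →
          |f (a + b) - f a - f b| ≤ S * T ^ (β + α) := by
        intro a b ha hb hab
        refine (hadd a b ha hb hab).trans ?_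
        rw [Real.rpow_add hT, mul_assoc, mul_comm (a ^ α)]
        gcongr <;> linarith
      have h1 := abs_sub_linear_le_of_almost_additive hT hf hTS ⟨ht.le, htT⟩
      have h2 : |f t| ≤ t / T * |f T| + 3 * (S * T ^ (β + α)) := by
        have h3 := abs_sub_abs_le_abs_sub (f t) (t / T * f T)
        rw [abs_mul, abs_of_pos (div_pos ht hT)] at h3
        linarith
      have h3 : T ^ (β + α) ≤ 2 * t ^ (β + α) := by
        calc T ^ (β + α) ≤ (2 * t) ^ (β + α) := by gcongr
          _ = 2 * q * t ^ (β + α) := by rw [Real.mul_rpow (by norm_num) ht.le, h2q]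
          _ ≤ 2 * t ^ (β + α) := by
            have : 0 < t ^ (β + α) := by positivity
            nlinarith
      have h4 : t / T * |f T| ≤ G * t ^ (β + α) := by
        have h5 : t / T ≤ (t / T) ^ (β + α) :=
          Real.self_le_rpow_of_le_one (by positivity) ((div_le_one hT).2 htT) (by linarith)
        calc t / T * |f T| ≤ (t / T) ^ (β + α) * |f T| := by gcongr
          _ = G * t ^ (β + α) := by rw [Real.div_rpow ht.le hT.le, hG]; ring
      have h5 : 3 * (S * T ^ (β + α)) ≤ D * S * t ^ (β + α) := by
        calc 3 * (S * T ^ (β + α)) ≤ 3 * (S * (2 * t ^ (β + α))) := by gcongr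
          _ = 6 * S * t ^ (β + α) := by ring
          _ ≤ D * S * t ^ (β + α) := by gcongr
      linarith
    | succ n ih =>
      intro t ht htT hTt
      rcases le_total (t + t) T with h2t | h2t
      · have h1 := ih (t + t) (by linarith) h2t (by rw [pow_succ] at hTt; linarith)
        rw [← two_mul, Real.mul_rpow (by norm_num) ht.le, h2q, two_mul t] at h1
        have h2 := hadd t t ht.le ht.le h2t
        rw [mul_assoc, ← Real.rpow_add ht, add_comm α β] at h2
        have h3 : 2 * |f t| ≤ |f (t + t)| + |f (t + t) - f t - f t| := by
          have h := abs_sub_abs_le_abs_sub (2 * f t) (f (t + t))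
          rw [abs_mul, abs_two, abs_sub_comm,
            show f (t + t) - 2 * f t = f (t + t) - f t - f t by ring] at h
          linarith
        have h4 : q * (G + D * S) + S / 2 ≤ G + D * S := by
          nlinarith [mul_nonneg hG0 (sub_pos.2 hq1).le, congrArg (· * S) hDq]
        have h5 := mul_le_mul_of_nonneg_right h4 (Real.rpow_nonneg ht.le (β + α))
        linarith
      · refine ih t ht htT (h2t.trans ?_)
        rw [← two_mul]
        gcongr
        exact le_self_pow₀ (by norm_num) (by simp)
  obtain ⟨n, hn⟩ := pow_unbounded_of_one_lt (T / τ) (one_lt_two (α := ℝ))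
  refine key n τ hτ hτT ?_
  rw [div_lt_iff₀ hτ] at hn
  rw [pow_succ]
  nlinarith

/-- **Corollary 5.2**: for `α + β < 1` there is `C`, depending only on `m = 1 - (α+β)`,
such that for every continuous `u : [-1,0] → ℝ` and every `τ̄ ∈ (0,1)`:
(i) `sup_{τ∈(0,τ̄)} |u(0)-u(-τ)|/τ^{β+α} ≤ |u(0)-u(-τ̄)|/τ̄^{β+α} + C S`, and
(ii) `sup_{τ∈(τ̄,1)} |u(0)-u(-τ)|/τ^β ≥ (1/2) sup_{τ∈(0,1)} |u(0)-u(-τ)|/τ^β - C τ̄^α S`,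
where `S` bounds the Hölder seminorms `[δ_τ u/τ^β]_{C^{0,α}_*([-1+τ,0])}` for `τ ∈ (0,1)`.
In (ii) the supremum over `(τ̄,1)` is expressed through an arbitrary upper bound `M`. -/
theorem difference_quotient_tail_control (m : ℝ) (hm : 0 < m) :
    ∃ C > 0, ∀ α β : ℝ, α ∈ Ioo (0 : ℝ) 1 → β ∈ Ioo (0 : ℝ) 1 → 1 - (α + β) = m →
      ∀ u : ℝ → ℝ, ContinuousOn u (Icc (-1 : ℝ) 0) →
      ∀ tb ∈ Ioo (0 : ℝ) 1, ∀ S : ℝ,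
        (∀ τ ∈ Ioo (0 : ℝ) 1, ∀ s ∈ Icc (-1 + τ) (0 : ℝ), ∀ t ∈ Icc (-1 + τ) (0 : ℝ),
          |(u t - u (t - τ)) / τ ^ β - (u s - u (s - τ)) / τ ^ β| ≤ S * |t - s| ^ α) →
        (∀ τ ∈ Ioo (0 : ℝ) tb,
          |u 0 - u (-τ)| / τ ^ (β + α) ≤ |u 0 - u (-tb)| / tb ^ (β + α) + C * S) ∧
        (∀ M : ℝ, (∀ τ ∈ Ioo tb 1, |u 0 - u (-τ)| / τ ^ β ≤ M) →
          ∀ τ ∈ Ioo (0 : ℝ) 1,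
            (1 / 2) * (|u 0 - u (-τ)| / τ ^ β) - C * tb ^ α * S ≤ M) := by
  have hq1 : (2 : ℝ) ^ (-m) < 1 :=
    Real.rpow_lt_one_of_one_lt_of_neg (by norm_num) (by linarith)
  refine ⟨6 / (1 - (2 : ℝ) ^ (-m)), div_pos (by norm_num) (by linarith), ?_⟩
  rintro α β ⟨hα, -⟩ ⟨hβ, -⟩ hm' u hu tb ⟨htb, htb1⟩ S hS
  set C : ℝ := 6 / (1 - (2 : ℝ) ^ (-m)) with hC
  have hS0 : 0 ≤ S := by
    have h := (abs_nonneg _).trans (hS (1 / 2) (by norm_num) 0 (by norm_num) (-1 / 2)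
      (by norm_num))
    exact nonneg_of_mul_nonneg_left h (by positivity)
  set f : ℝ → ℝ := fun t => u 0 - u (-t) with hf
  have hadd : ∀ a b : ℝ, 0 ≤ a → 0 ≤ b → a + b < 1 →
      |f (a + b) - f a - f b| ≤ S * a ^ α * b ^ β := by
    intro a b ha hb hab
    rcases hb.eq_or_lt with rfl | hb
    · simp [hf, Real.zero_rpow hβ.ne']
    have h := hS b ⟨hb, by linarith⟩ 0 ⟨by linarith, le_rfl⟩ (-a) ⟨by linarith, by linarith⟩
    rw [← sub_div, abs_div, abs_of_pos (Real.rpow_pos_of_pos hb β),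
      div_le_iff₀ (Real.rpow_pos_of_pos hb β), sub_zero, abs_neg, abs_of_nonneg ha] at h
    have heq : f (a + b) - f a - f b = u (-a) - u (-a - b) - (u 0 - u (0 - b)) := by
      simp only [hf]
      rw [show -(a + b) = -a - b by ring, zero_sub]
      ring
    rwa [heq]
  have main : ∀ T : ℝ, 0 < T → T < 1 → ∀ τ : ℝ, 0 < τ → τ ≤ T →
      |f τ| ≤ (|f T| / T ^ (β + α) + C * S) * τ ^ (β + α) := by
    intro T hT hT1 τ hτ hτT
    have hcont : ContinuousOn f (Icc 0 T) := by
      refine continuousOn_const.sub (hu.comp continuousOn_neg ?_)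
      rintro x ⟨hx0, hx1⟩
      exact ⟨by linarith, by linarith⟩
    rw [hC, ← hm']
    exact abs_le_mul_rpow_of_almost_additive hT hα hβ (by linarith) hS0 hcont
      (fun a b ha hb hab => hadd a b ha hb (by linarith)) hτ hτT
  refine ⟨fun τ hτ => ?_, fun M hM τ hτ => ?_⟩
  · rw [div_le_iff₀ (Real.rpow_pos_of_pos hτ.1 _)]
    exact main tb htb htb1 τ hτ.1 hτ.2.le
  · have hC0 : 0 ≤ C := div_nonneg (by norm_num) (by linarith)
    have herr : 0 ≤ C * tb ^ α * S := by positivity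
    have hX : 0 ≤ |f τ| / τ ^ β := div_nonneg (abs_nonneg _) (Real.rpow_nonneg hτ.1.le _)
    suffices |f τ| / τ ^ β ≤ M + C * tb ^ α * S by
      change 1 / 2 * (|f τ| / τ ^ β) - C * tb ^ α * S ≤ M
      linarith
    rcases lt_or_ge tb τ with h | h
    · linarith [hM τ ⟨h, hτ.2⟩]
    obtain ⟨T, hT, hT1⟩ := exists_between htb1
    have hT0 : 0 < T := htb.trans hT
    have hτ0 : 0 < τ := hτ.1
    have hMT : |f T| / T ^ β ≤ M := hM T ⟨hT, hT1⟩
    rw [div_le_iff₀ (Real.rpow_pos_of_pos hτ0 _)]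
    calc |f τ| ≤ (|f T| / T ^ (β + α) + C * S) * τ ^ (β + α) :=
          main T hT0 hT1 τ hτ0 (h.trans hT.le)
      _ = (|f T| / T ^ β * (τ ^ α / T ^ α) + C * τ ^ α * S) * τ ^ β := by
        rw [Real.rpow_add hT0, Real.rpow_add hτ0]
        field_simp
      _ ≤ (|f T| / T ^ β * 1 + C * tb ^ α * S) * τ ^ β := by
        gcongr
        exact div_le_one_of_le₀ (by gcongr; linarith) (by positivity)
      _ ≤ (M + C * tb ^ α * S) * τ ^ β := by
        rw [mul_one]
        gcongr
end

section
/- (Hölder regularity of the derivative from second differences.) Let α, β ∈ (0,1) with α + β > 1, and let u : [−1,1] → ℝ be continuous such that osc_{[−1,1]} u + sup { |u(t) − 2u(t−τ) + u(t−2τ)| / τ^{α+β} : τ > 0, −1 ≤ t−2τ < t ≤ 1 } ≤ 1. Then u is differentiable at every point of (−1,1), and there is a constant C > 0 depending only on α+β−1 such that sup_{(−1,1)} |u'| + sup_{s≠t∈(−1,1)} |u'(t)−u'(s)| / |t−s|^{α+β−1} ≤ C. -/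
open Set

open Filter Topology

section SecondDifferences

variable {u : ℝ → ℝ} {a b S m x h : ℝ}

/-- Forward difference quotients along the steps `h / 2 ^ k` change geometrically in `k`. -/
lemma dist_diffQuot_halving_le (hS : 0 ≤ S)
    (H : ∀ y τ, 0 < τ → a ≤ y - τ → y + τ ≤ b →
      |u (y + τ) - 2 * u y + u (y - τ)| ≤ S * τ ^ (1 + m))
    (hh : 0 < h) (hax : a ≤ x) (hxb : x + h ≤ b) (k : ℕ) :
    dist ((u (x + h / 2 ^ k) - u x) / (h / 2 ^ k))
      ((u (x + h / 2 ^ (k + 1)) - u x) / (h / 2 ^ (k + 1))) ≤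
        S * (h / 2) ^ m * ((1 / 2 : ℝ) ^ m) ^ k := by
  set τ := h / 2 ^ (k + 1) with hτ
  have hτ0 : 0 < τ := by positivity
  have hk : h / 2 ^ k = 2 * τ := by rw [hτ]; field_simp; ring
  have hle : 2 * τ ≤ h := by
    rw [← hk]; exact div_le_self hh.le (one_le_pow₀ (by norm_num))
  have hpow : (h / 2) ^ m * ((1 / 2 : ℝ) ^ m) ^ k = τ ^ m := by
    rw [← Real.rpow_natCast, ← Real.rpow_mul (by norm_num), mul_comm m, Real.rpow_mul (by norm_num),
      ← Real.mul_rpow (by positivity) (by positivity), Real.rpow_natCast, hτ]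
    congr 1
    field_simp
    rw [pow_succ, ← mul_assoc, ← mul_pow]; norm_num
  have key := H (x + τ) τ hτ0 (by linarith) (by linarith)
  rw [show x + τ + τ = x + 2 * τ by ring, add_sub_cancel_right, Real.rpow_add hτ0,
    Real.rpow_one] at key
  rw [hk, mul_assoc, hpow, Real.dist_eq,
    show (u (x + 2 * τ) - u x) / (2 * τ) - (u (x + τ) - u x) / τ =
      (u (x + 2 * τ) - 2 * u (x + τ) + u x) / (2 * τ) by field_simp; ring,
    abs_div, abs_of_pos (by positivity : 0 < 2 * τ), div_le_iff₀ (by positivity)]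
  have : 0 ≤ S * τ ^ m * τ := by positivity
  nlinarith

lemma tendsto_div_two_pow (h : ℝ) : Tendsto (fun k : ℕ => h / 2 ^ k) atTop (𝓝 0) := by
  simpa [div_eq_mul_inv] using
    (tendsto_pow_atTop_nhds_zero_of_lt_one (r := (2⁻¹ : ℝ)) (by norm_num) (by norm_num)).const_mul h

lemma HasDerivAt.tendsto_diffQuot_halving {f : ℝ → ℝ} {f' : ℝ} (hf : HasDerivAt f f' x)
    (hh : h ≠ 0) :
    Tendsto (fun k : ℕ => (f (x + h / 2 ^ k) - f x) / (h / 2 ^ k)) atTop (𝓝 f') := by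
  have hlim : Tendsto (fun k : ℕ => h / 2 ^ k) atTop (𝓝[≠] 0) :=
    tendsto_nhdsWithin_iff.2 ⟨tendsto_div_two_pow h, Eventually.of_forall fun k => by
      simp [hh]⟩
  refine (hf.tendsto_slope_zero.comp hlim).congr fun k => ?_
  simp [div_eq_inv_mul]

lemma one_half_rpow_lt_one (hm : 0 < m) : (1 / 2 : ℝ) ^ m < 1 :=
  Real.rpow_lt_one (by norm_num) (by norm_num) hm

/-- A continuous function whose second differences are `O(τ ^ (1 + m))` is differentiable. -/
lemma differentiableAt_of_second_diff_le (hm : 0 < m) (hS : 0 ≤ S)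
    (hu : ContinuousOn u (Icc a b))
    (H : ∀ y τ, 0 < τ → a ≤ y - τ → y + τ ≤ b →
      |u (y + τ) - 2 * u y + u (y - τ)| ≤ S * τ ^ (1 + m))
    (hx : x ∈ Ioo a b) : DifferentiableAt ℝ u x := by
  have hab : a ≤ b := (hx.1.trans hx.2).le
  set h := (b - x) / 2 with hdef
  have hh : 0 < h := by have := hx.2; simp only [hdef]; linarith
  have hxs : x ∈ Ioo a (b - h) := ⟨hx.1, by linarith [hx.2]⟩
  set r := (1 / 2 : ℝ) ^ m
  have hr : r < 1 := one_half_rpow_lt_one hm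
  have hr0 : 0 ≤ r := by positivity
  -- Replace `u` by a continuous function on the line and approximate it by its averages.
  set v : ℝ → ℝ := IccExtend hab ((Icc a b).domRestrict u)
  have hv : Continuous v := (continuousOn_iff_continuous_domRestrict.1 hu).Icc_extend'
  have hvu : ∀ y ∈ Icc a b, v y = u y := fun y hy => IccExtend_of_mem hab _ hy
  set V : ℝ → ℝ := fun y => ∫ s in (0 : ℝ)..y, v s
  have hV : ∀ y, HasDerivAt V (v y) y := fun y => hv.integral_hasStrictDerivAt 0 y |>.hasDerivAt
  have hmean : ∀ (k : ℕ) (y : ℝ), HasDerivAt (fun z => (V (z + h / 2 ^ k) - V z) / (h / 2 ^ k))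
      ((v (y + h / 2 ^ k) - v y) / (h / 2 ^ k)) y := fun k y =>
    (((hV _).comp_add_const y _).sub (hV y)).div_const _
  have hstep : ∀ y ∈ Ioo a (b - h), ∀ k : ℕ,
      dist ((v (y + h / 2 ^ k) - v y) / (h / 2 ^ k))
        ((v (y + h / 2 ^ (k + 1)) - v y) / (h / 2 ^ (k + 1))) ≤ S * (h / 2) ^ m * r ^ k := by
    intro y hy k
    have hmem : ∀ j : ℕ, y + h / 2 ^ j ∈ Icc a b := fun j => by
      have h1 : h / 2 ^ j ≤ h := div_le_self hh.le (one_le_pow₀ (by norm_num))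
      have h2 : 0 < h / 2 ^ j := by positivity
      exact ⟨by linarith [hy.1], by linarith [hy.2]⟩
    rw [hvu _ (hmem k), hvu _ (hmem (k + 1)), hvu y ⟨hy.1.le, by linarith [hy.2]⟩]
    exact dist_diffQuot_halving_le hS H hh hy.1.le (by linarith [hy.2]) k
  have hlim : ∀ y ∈ Ioo a (b - h), ∃ l,
      Tendsto (fun k : ℕ => (v (y + h / 2 ^ k) - v y) / (h / 2 ^ k)) atTop (𝓝 l) := fun y hy =>
    cauchySeq_tendsto_of_complete (cauchySeq_of_le_geometric _ _ hr (hstep y hy))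
  choose! g hg using hlim
  have hunif : TendstoUniformlyOn (fun (k : ℕ) y => (v (y + h / 2 ^ k) - v y) / (h / 2 ^ k)) g
      atTop (Ioo a (b - h)) := by
    have hbound : Tendsto (fun k : ℕ => S * (h / 2) ^ m * r ^ k / (1 - r)) atTop (𝓝 0) := by
      simpa using ((tendsto_pow_atTop_nhds_zero_of_lt_one hr0 hr).const_mul
        (S * (h / 2) ^ m)).div_const (1 - r)
    rw [Metric.tendstoUniformlyOn_iff]
    intro ε hε
    filter_upwards [hbound.eventually_lt_const hε] with k hk y hy
    rw [dist_comm]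
    exact (dist_le_of_le_geometric_of_tendsto r _ hr (hstep y hy) (hg y hy) k).trans_lt hk
  have hderiv : HasDerivAt v (g x) x :=
    hasDerivAt_of_tendstoUniformlyOn isOpen_Ioo hunif
      (Eventually.of_forall fun k y _ => hmean k y)
      (fun y _ => (hV y).tendsto_diffQuot_halving hh.ne') hxs
  refine (hderiv.congr_of_eventuallyEq ?_).differentiableAt
  filter_upwards [Icc_mem_nhds hx.1 hx.2] with y hy using (hvu y hy).symm

/-- The derivative at the left endpoint is close to the difference quotient. -/
lemma abs_diffQuot_sub_deriv_le (hm : 0 < m) (hS : 0 ≤ S)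
    (H : ∀ y τ, 0 < τ → a ≤ y - τ → y + τ ≤ b →
      |u (y + τ) - 2 * u y + u (y - τ)| ≤ S * τ ^ (1 + m))
    (hu : DifferentiableAt ℝ u x) (hh : 0 < h) (hax : a ≤ x) (hxb : x + h ≤ b) :
    |(u (x + h) - u x) / h - deriv u x| ≤ S * h ^ m / (1 - (1 / 2 : ℝ) ^ m) := by
  have hr := one_half_rpow_lt_one hm
  have hdist := dist_le_of_le_geometric_of_tendsto₀ _ _ hr
    (dist_diffQuot_halving_le hS H hh hax hxb) (hu.hasDerivAt.tendsto_diffQuot_halving hh.ne')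
  simp only [pow_zero, div_one, Real.dist_eq] at hdist
  refine hdist.trans (div_le_div_of_nonneg_right ?_ (by linarith))
  gcongr
  linarith

/-- The derivative at the right endpoint is close to the difference quotient. -/
lemma abs_backward_diffQuot_sub_deriv_le (hm : 0 < m) (hS : 0 ≤ S)
    (H : ∀ y τ, 0 < τ → a ≤ y - τ → y + τ ≤ b →
      |u (y + τ) - 2 * u y + u (y - τ)| ≤ S * τ ^ (1 + m))
    (hu : DifferentiableAt ℝ u x) (hh : 0 < h) (hax : a ≤ x - h) (hxb : x ≤ b) :
    |(u x - u (x - h)) / h - deriv u x| ≤ S * h ^ m / (1 - (1 / 2 : ℝ) ^ m) := by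
  have hrefl := abs_diffQuot_sub_deriv_le (u := fun y => u (-y)) (a := -b) (b := -a) (x := -x)
    (h := h) hm hS
    (fun y τ hτ h1 h2 => by
      have := H (-y) τ hτ (by linarith) (by linarith)
      rw [show -(y + τ) = -y - τ by ring, show -(y - τ) = -y + τ by ring]
      rwa [show u (-y - τ) - 2 * u (-y) + u (-y + τ) =
        u (-y + τ) - 2 * u (-y) + u (-y - τ) by ring])
    (by rw [← neg_neg x] at hu; exact hu.comp (-x) differentiableAt_id.neg) hh (by linarith)
    (by linarith)
  rw [deriv_comp_neg, neg_neg, show -(-x + h) = x - h by ring, abs_sub_comm] at hrefl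
  rwa [show (u x - u (x - h)) / h - deriv u x = -deriv u x - (u (x - h) - u x) / h by ring]

end SecondDifferences

/-- **Hölder regularity of the derivative from second differences** (Lemma 5.3):
if `α + β > 1` and `u : [-1,1] → ℝ` is continuous with
`osc u + sup |δ²_τ u(t)|/τ^{α+β} ≤ 1`, then `u` is differentiable on `(-1,1)` and
`sup |u'| + [u']_{C^{0,α+β-1}_*} ≤ C` with `C` depending only on `m = α + β - 1`.
The supremum of the second differences is represented by an upper bound `S`. -/
theorem derivative_regularity_from_second_differences (m : ℝ) (hm : 0 < m) :
    ∃ C > 0, ∀ α β : ℝ, α ∈ Ioo (0 : ℝ) 1 → β ∈ Ioo (0 : ℝ) 1 → α + β - 1 = m →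
      ∀ u : ℝ → ℝ, ContinuousOn u (Icc (-1 : ℝ) 1) →
      ∀ S : ℝ,
        (∀ τ : ℝ, 0 < τ → ∀ t : ℝ, -1 ≤ t - 2 * τ → t ≤ 1 →
          |u t - 2 * u (t - τ) + u (t - 2 * τ)| ≤ S * τ ^ (α + β)) →
        (sSup (u '' Icc (-1 : ℝ) 1) - sInf (u '' Icc (-1 : ℝ) 1)) + S ≤ 1 →
        (∀ t ∈ Ioo (-1 : ℝ) 1, DifferentiableAt ℝ u t) ∧
        ∃ C₀ C₁ : ℝ, 0 ≤ C₀ ∧ 0 ≤ C₁ ∧ C₀ + C₁ ≤ C ∧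
          (∀ t ∈ Ioo (-1 : ℝ) 1, |deriv u t| ≤ C₀) ∧
          ∀ s ∈ Ioo (-1 : ℝ) 1, ∀ t ∈ Ioo (-1 : ℝ) 1,
            |deriv u t - deriv u s| ≤ C₁ * |t - s| ^ (α + β - 1) := by
  set K := 1 / (1 - (1 / 2 : ℝ) ^ m) with hK
  have hK0 : 0 < K := one_div_pos.2 (sub_pos.2 (one_half_rpow_lt_one hm))
  refine ⟨1 + K + 2 * K, by positivity, ?_⟩
  rintro α β - - hαβ u hu S hS hosc
  have hbdd := isCompact_Icc.image_of_continuousOn hu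
  have hosc_le : ∀ s ∈ Icc (-1 : ℝ) 1, ∀ t ∈ Icc (-1 : ℝ) 1,
      u s - u t ≤ sSup (u '' Icc (-1 : ℝ) 1) - sInf (u '' Icc (-1 : ℝ) 1) := fun s hs t ht =>
    sub_le_sub (le_csSup hbdd.bddAbove (mem_image_of_mem u hs))
      (csInf_le hbdd.bddBelow (mem_image_of_mem u ht))
  have hS0 : 0 ≤ S := by
    simpa using (abs_nonneg _).trans (hS 1 one_pos 1 (by norm_num) le_rfl)
  have hS1 : S ≤ 1 := by
    have := hosc_le 0 (by norm_num) 0 (by norm_num)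
    linarith
  have hu1 : ∀ s ∈ Icc (-1 : ℝ) 1, ∀ t ∈ Icc (-1 : ℝ) 1, |u s - u t| ≤ 1 := fun s hs t ht =>
    abs_le.2 ⟨by linarith [hosc_le t ht s hs], by linarith [hosc_le s hs t ht]⟩
  have H : ∀ y τ, 0 < τ → -1 ≤ y - τ → y + τ ≤ 1 →
      |u (y + τ) - 2 * u y + u (y - τ)| ≤ 1 * τ ^ (1 + m) := by
    intro y τ hτ h1 h2
    have := hS τ hτ (y + τ) (by linarith) h2
    rw [add_sub_cancel_right, show y + τ - 2 * τ = y - τ by ring,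
      show α + β = 1 + m by linarith] at this
    exact this.trans (by gcongr)
  have hd : ∀ t ∈ Ioo (-1 : ℝ) 1, DifferentiableAt ℝ u t := fun t ht =>
    differentiableAt_of_second_diff_le hm zero_le_one hu H ht
  have hK' : ∀ h : ℝ, 1 * h ^ m / (1 - (1 / 2 : ℝ) ^ m) = K * h ^ m := fun h => by
    rw [hK]; ring
  have hright : ∀ t ∈ Ioo (-1 : ℝ) 1, ∀ h, 0 < h → t + h ≤ 1 →
      |(u (t + h) - u t) / h - deriv u t| ≤ K * h ^ m := fun t ht h hh hth =>
    (abs_diffQuot_sub_deriv_le hm zero_le_one H (hd t ht) hh ht.1.le hth).trans_eq (hK' h)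
  have hleft : ∀ t ∈ Ioo (-1 : ℝ) 1, ∀ h, 0 < h → -1 ≤ t - h →
      |(u t - u (t - h)) / h - deriv u t| ≤ K * h ^ m := fun t ht h hh hth =>
    (abs_backward_diffQuot_sub_deriv_le hm zero_le_one H (hd t ht) hh hth ht.2.le).trans_eq (hK' h)
  have hlt : ∀ s ∈ Ioo (-1 : ℝ) 1, ∀ t ∈ Ioo (-1 : ℝ) 1, s < t →
      |deriv u t - deriv u s| ≤ 2 * K * |t - s| ^ m := by
    intro s hs t ht hst
    have h1 := hright s hs (t - s) (by linarith) (by linarith [ht.2])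
    have h2 := hleft t ht (t - s) (by linarith) (by linarith [hs.1])
    rw [add_sub_cancel] at h1
    rw [sub_sub_cancel] at h2
    rw [abs_of_pos (sub_pos.2 hst)]
    rw [abs_le] at *
    constructor <;> linarith
  refine ⟨hd, 1 + K, 2 * K, by positivity, by positivity, le_rfl, fun t ht => ?_,
    fun s hs t ht => ?_⟩
  · have ht' : t ∈ Icc (-1 : ℝ) 1 := Ioo_subset_Icc_self ht
    rcases le_total t 0 with h0 | h0
    · have h1 := hright t ht 1 one_pos (by linarith)
      have h2 := hu1 (t + 1) ⟨by linarith [ht.1], by linarith⟩ t ht'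
      rw [div_one, Real.one_rpow, mul_one] at h1
      rw [abs_le] at *
      constructor <;> linarith
    · have h1 := hleft t ht 1 one_pos (by linarith)
      have h2 := hu1 t ht' (t - 1) ⟨by linarith, by linarith [ht.2]⟩
      rw [div_one, Real.one_rpow, mul_one] at h1
      rw [abs_le] at *
      constructor <;> linarith
  · rw [hαβ]
    rcases lt_trichotomy s t with hst | rfl | hst
    · exact hlt s hs t ht hst
    · rw [sub_self, abs_zero]; positivity
    · rw [abs_sub_comm, abs_sub_comm t s]; exact hlt t ht s hs hst
end

section
/- (Pointwise C^{1,α+β−1} estimate at a point of differentiability.) Let α, β ∈ (0,1) with α + β > 1, and let u : [−1,1] → ℝ satisfy |u(t) − 2u(t−τ) + u(t−2τ)| ≤ τ^{α+β} whenever τ > 0 and −1 ≤ t−2τ < t ≤ 1. If u is differentiable at a point t₀ ∈ (−1,1), then for every t ∈ [−1,1], |u(t) − u(t₀) − u'(t₀)(t−t₀)| ≤ C |t−t₀|^{α+β}, where C = 4/(2^{α+β−1} − 1). -/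
open Set

/-- If `f(s) = o(s)` at `0` and `f` is almost additive under halving along the sequence `h / 2 ^ k`,
up to errors of order `γ > 1`, then `f` is of order `γ` at `h`. -/
theorem abs_le_rpow_of_abs_sub_two_mul_half_le {f : ℝ → ℝ} {γ h : ℝ} (hγ : 1 < γ)
    (hf : f =o[nhds 0] fun s => s)
    (hhalf : ∀ k : ℕ, |f (h / 2 ^ k) - 2 * f (h / 2 ^ k / 2)| ≤ (|h / 2 ^ k| / 2) ^ γ) :
    |f h| ≤ 1 / ((2 : ℝ) ^ γ - 2) * |h| ^ γ := by
  have h2γ : (2 : ℝ) < 2 ^ γ := by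
    simpa using Real.rpow_lt_rpow_of_exponent_lt (x := 2) one_lt_two hγ
  set c : ℝ := 1 / ((2 : ℝ) ^ γ - 2) with hc
  have hc0 : 0 ≤ c := by
    rw [hc]
    exact one_div_nonneg.2 (by linarith)
  have hstep : ∀ k : ℕ, |f h| - c * |h| ^ γ ≤
      2 ^ k * (|f (h / 2 ^ k)| - c * |h / 2 ^ k| ^ γ) := by
    intro k
    induction k with
    | zero => simp
    | succ k ih =>
      have hk := hhalf k
      rw [pow_succ, ← div_div, mul_assoc]
      refine ih.trans (mul_le_mul_of_nonneg_left ?_ (by positivity))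
      generalize h / 2 ^ k = x at hk
      have hx : |x| ^ γ = 2 ^ γ * (|x| / 2) ^ γ := by
        rw [← Real.mul_rpow (by norm_num) (by positivity)]
        congr 1
        ring
      have hx2 : |x / 2| = |x| / 2 := by rw [abs_div, abs_two]
      have hcx : c * (2 ^ γ - 2) = 1 := by
        rw [hc]
        exact one_div_mul_cancel (by linarith)
      have htri : |f x| ≤ |f x - 2 * f (x / 2)| + 2 * |f (x / 2)| := by
        have := abs_add_le (f x - 2 * f (x / 2)) (2 * f (x / 2))
        rwa [sub_add_cancel, abs_mul, abs_two] at this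
      rw [hx2, hx]
      linear_combination htri + hk - (|x| / 2) ^ γ * hcx
  have hlim : Filter.Tendsto (fun k : ℕ => h / 2 ^ k) Filter.atTop (nhds 0) := by
    simpa [div_eq_mul_inv, inv_pow] using
      (tendsto_pow_atTop_nhds_zero_of_lt_one (r := (2 : ℝ)⁻¹) (by norm_num)
        (by norm_num)).const_mul h
  have hsmall : ∀ ε : ℝ, 0 < ε → |f h| - c * |h| ^ γ ≤ ε * |h| := by
    intro ε hε
    obtain ⟨k, hk⟩ := (hlim.eventually (hf.def hε)).exists
    rw [Real.norm_eq_abs, Real.norm_eq_abs] at hk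
    have hpow : (0 : ℝ) < 2 ^ k := by positivity
    calc |f h| - c * |h| ^ γ ≤ 2 ^ k * (|f (h / 2 ^ k)| - c * |h / 2 ^ k| ^ γ) := hstep k
      _ ≤ 2 ^ k * (ε * |h / 2 ^ k|) := by
        refine mul_le_mul_of_nonneg_left ?_ hpow.le
        have : 0 ≤ c * |h / 2 ^ k| ^ γ := by positivity
        linarith
      _ = ε * |h| := by
        rw [abs_div, abs_of_pos hpow]
        field_simp
  have hlim0 : Filter.Tendsto (fun ε : ℝ => ε * |h|) (nhdsWithin 0 (Ioi 0)) (nhds 0) := by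
    simpa using ((continuous_mul_const |h|).tendsto 0).mono_left nhdsWithin_le_nhds
  have := ge_of_tendsto hlim0 (Filter.eventually_of_mem self_mem_nhdsWithin hsmall)
  linarith

/-- Bounds on backward second differences are symmetric: on `[-1, 1]` they control the second
difference of `u` at `x`, `x + s / 2` and `x + s` for either sign of `s`. -/
theorem abs_secondDiff_le_of_backward {u : ℝ → ℝ} {γ : ℝ} (hγ : 1 < γ)
    (h2 : ∀ τ : ℝ, 0 < τ → ∀ t : ℝ, -1 ≤ t - 2 * τ → t ≤ 1 →
      |u t - 2 * u (t - τ) + u (t - 2 * τ)| ≤ τ ^ γ)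
    {x s : ℝ} (hx : x ∈ Icc (-1 : ℝ) 1) (hxs : x + s ∈ Icc (-1 : ℝ) 1) :
    |u (x + s) - 2 * u (x + s / 2) + u x| ≤ (|s| / 2) ^ γ := by
  rcases lt_trichotomy s 0 with hs | rfl | hs
  · have := h2 (-s / 2) (by linarith) x (by linarith [hxs.1]) hx.2
    rw [show x - -s / 2 = x + s / 2 by ring, show x - 2 * (-s / 2) = x + s by ring] at this
    rw [abs_of_neg hs]
    convert this using 2
    ring
  · simp [Real.zero_rpow (by linarith : γ ≠ 0), two_mul]
  · have := h2 (s / 2) (by linarith) (x + s) (by linarith [hx.1]) hxs.2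
    rw [show x + s - s / 2 = x + s / 2 by ring, show x + s - 2 * (s / 2) = x by ring] at this
    rwa [abs_of_pos hs]

/-- **Pointwise `C^{1,α+β-1}` estimate at a point of differentiability** (from the proof of
Lemma 5.3): if `α + β > 1`, all second backward differences of `u` in `[-1,1]` satisfy
`|δ²_τ u(t)| ≤ τ^{α+β}`, and `u` is differentiable at `t₀ ∈ (-1,1)` with derivative `d`,
then `|u(t) - u(t₀) - d (t - t₀)| ≤ (4/(2^{α+β-1}-1)) |t - t₀|^{α+β}` on `[-1,1]`. -/
theorem pointwise_C1_estimate (α β : ℝ)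
    (hα : α ∈ Ioo (0 : ℝ) 1) (hβ : β ∈ Ioo (0 : ℝ) 1) (hab : 1 < α + β)
    (u : ℝ → ℝ)
    (h2 : ∀ τ : ℝ, 0 < τ → ∀ t : ℝ, -1 ≤ t - 2 * τ → t ≤ 1 →
      |u t - 2 * u (t - τ) + u (t - 2 * τ)| ≤ τ ^ (α + β))
    (t₀ : ℝ) (ht₀ : t₀ ∈ Ioo (-1 : ℝ) 1) (d : ℝ) (hd : HasDerivAt u d t₀) :
    ∀ t ∈ Icc (-1 : ℝ) 1,
      |u t - u t₀ - d * (t - t₀)| ≤ (4 / ((2 : ℝ) ^ (α + β - 1) - 1)) * |t - t₀| ^ (α + β) := by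
  intro t ht
  have hlit : (fun s => u (t₀ + s) - u t₀ - d * s) =o[nhds 0] fun s => s := by
    simpa [mul_comm] using hasDerivAt_iff_isLittleO_nhds_zero.1 hd
  have hmem : ∀ k : ℕ, t₀ + (t - t₀) / 2 ^ k ∈ Icc (-1 : ℝ) 1 := by
    intro k
    have := (convex_Icc (-1 : ℝ) 1).add_smul_sub_mem (Ioo_subset_Icc_self ht₀) ht
      (t := ((2 : ℝ) ^ k)⁻¹) ⟨by positivity, inv_le_one_of_one_le₀ (one_le_pow₀ one_le_two)⟩
    rwa [smul_eq_mul, inv_mul_eq_div] at this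
  have hmain := abs_le_rpow_of_abs_sub_two_mul_half_le (h := t - t₀) hab hlit (fun k => by
    convert abs_secondDiff_le_of_backward hab h2 (Ioo_subset_Icc_self ht₀) (hmem k) using 2
    ring)
  simp only [add_sub_cancel] at hmain
  refine hmain.trans (mul_le_mul_of_nonneg_right ?_ (by positivity))
  have hone : (1 : ℝ) < 2 ^ (α + β - 1) := Real.one_lt_rpow one_lt_two (by linarith)
  have hsplit : (2 : ℝ) ^ (α + β) = 2 ^ (α + β - 1) * 2 := by
    rw [Real.rpow_sub_one two_ne_zero]
    ring
  exact div_le_div₀ (by norm_num) (by norm_num) (by linarith) (by linarith)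
end

section
/- (First differences controlled by second differences in L¹.) Let β ∈ (0,1) and let u : (−1,0] → L¹(B₁) be continuous (B₁ the unit ball of ℝⁿ). Then there is a constant C > 0 depending only on β such that sup { ‖u(t) − u(t−τ)‖_{L¹(B₁)} / τ^β : τ > 0, (t−τ,t] ⊆ (−1,0] } ≤ C ( sup_{t∈(−1,0]} ‖u(t)‖_{L¹(B₁)} + sup { ‖u(t) − 2u(t−τ) + u(t−2τ)‖_{L¹(B₁)} / τ^β : τ > 0, (t−2τ,t] ⊆ (−1,0] } ). -/
open Set MeasureTheory Metric

/-- In a real normed space, a bounded function on `[-1, 0]` whose second differences are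
`O(τ ^ β)` has first differences of order `O(τ ^ β)`, provided `β < 1`. -/
theorem norm_sub_le_rpow_of_second_difference_le {E : Type*} [NormedAddCommGroup E]
    [NormedSpace ℝ E] {β : ℝ} (hβ : β ≤ 1) {u : ℝ → E} {M N K : ℝ}
    (hM : ∀ t ∈ Icc (-1 : ℝ) 0, ‖u t‖ ≤ M)
    (hN : ∀ τ : ℝ, 0 < τ → ∀ t : ℝ, -1 ≤ t - 2 * τ → t ≤ 0 →
      ‖u t - (2 : ℝ) • u (t - τ) + u (t - 2 * τ)‖ ≤ N * τ ^ β)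
    (hMK : 6 * M ≤ K) (hNK : N ≤ K * (2 - 2 ^ β))
    {τ : ℝ} (hτ : 0 < τ) {t : ℝ} (ht : -1 ≤ t - τ) (ht0 : t ≤ 0) :
    ‖u t - u (t - τ)‖ ≤ K * τ ^ β := by
  have hM0 : 0 ≤ M := (norm_nonneg _).trans (hM 0 (by norm_num))
  obtain ⟨k, hk⟩ : ∃ k : ℕ, 1 / 3 < 2 ^ k * τ := by
    obtain ⟨k, hk⟩ := pow_unbounded_of_one_lt (1 / 3 / τ) (one_lt_two : (1 : ℝ) < 2)
    exact ⟨k, (div_lt_iff₀ hτ).1 hk⟩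
  induction k generalizing τ t with
  | zero =>
    have hτβ : 1 / 3 ≤ τ ^ β := by
      have := Real.rpow_le_rpow_of_exponent_ge hτ (by linarith) hβ
      rw [Real.rpow_one] at this
      linarith
    calc ‖u t - u (t - τ)‖ ≤ ‖u t‖ + ‖u (t - τ)‖ := norm_sub_le _ _
      _ ≤ M + M := add_le_add (hM _ ⟨by linarith, ht0⟩) (hM _ ⟨ht, by linarith⟩)
      _ ≤ K * (1 / 3) := by linarith
      _ ≤ K * τ ^ β := by gcongr; linarith
  | succ k ih =>
    -- it suffices to compare with a first difference of step `2 * τ`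
    have of_double {s : ℝ} (hs : -1 ≤ s - 2 * τ) (hs0 : s ≤ 0)
        (h : ‖(2 : ℝ) • (u t - u (t - τ))‖ ≤
          ‖u s - u (s - 2 * τ)‖ + ‖u s - (2 : ℝ) • u (s - τ) + u (s - 2 * τ)‖) :
        ‖u t - u (t - τ)‖ ≤ K * τ ^ β := by
      have h1 := ih (τ := 2 * τ) (by positivity) hs hs0 (by rwa [← mul_assoc, ← pow_succ])
      have h2 := hN τ hτ s hs hs0
      have h3 := mul_le_mul_of_nonneg_right hNK (Real.rpow_nonneg hτ.le β)
      rw [Real.mul_rpow zero_le_two hτ.le] at h1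
      rw [norm_smul, Real.norm_ofNat] at h
      linarith
    by_cases hback : -1 ≤ t - 2 * τ
    · refine of_double hback ht0 ((norm_add_le _ _).trans' (le_of_eq ?_))
      congr 1
      module
    by_cases hfwd : t + τ ≤ 0
    · refine of_double (s := t + τ) (by linarith) hfwd ((norm_sub_le _ _).trans' (le_of_eq ?_))
      rw [show t + τ - 2 * τ = t - τ by ring, add_sub_cancel_right]
      congr 1
      module
    · have hτ3 : 1 / 3 < τ := by linarith
      refine ih hτ ht ht0 (hτ3.trans_le ?_)
      exact le_mul_of_one_le_left hτ.le (one_le_pow₀ one_le_two)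

/-- **First differences controlled by second differences in `L¹`** (Lemma 5.4):
for a continuous curve `u : (-1,0] → L¹(B₁)` and `β ∈ (0,1)`,
`sup ‖δ_τ u(t)‖_{L¹(B₁)}/τ^β ≤ C (sup_t ‖u(t)‖_{L¹(B₁)} + sup ‖δ²_τ u(t)‖_{L¹(B₁)}/τ^β)`,
with `C` depending only on `β`; the suprema on the right are represented by upper
bounds `M₀` and `M₂`. -/
theorem first_differences_from_second_differences_L1 (β : ℝ) (hβ : β ∈ Ioo (0 : ℝ) 1) :
    ∃ C > 0, ∀ (n : ℕ)
      (u : ℝ → Lp ℝ 1 (volume.restrict (ball (0 : EuclideanSpace ℝ (Fin n)) 1))),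
      ContinuousOn u (Ioc (-1 : ℝ) 0) →
      ∀ M₀ M₂ : ℝ,
        (∀ t ∈ Ioc (-1 : ℝ) 0, ‖u t‖ ≤ M₀) →
        (∀ τ : ℝ, 0 < τ → ∀ t : ℝ, -1 ≤ t - 2 * τ → t ≤ 0 →
          ‖u t - (2 : ℝ) • u (t - τ) + u (t - 2 * τ)‖ ≤ M₂ * τ ^ β) →
        ∀ τ : ℝ, 0 < τ → ∀ t : ℝ, -1 ≤ t - τ → t ≤ 0 →
          ‖u t - u (t - τ)‖ ≤ C * (M₀ + M₂) * τ ^ β := by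
  have ha : 0 < 2 - (2 : ℝ) ^ β := by
    have := Real.rpow_lt_rpow_of_exponent_lt one_lt_two hβ.2
    rw [Real.rpow_one] at this
    linarith
  refine ⟨18 + 1 / (2 - 2 ^ β), by positivity, ?_⟩
  intro n u _ M₀ M₂ h₀ h₂ τ hτ t ht ht0
  have hM₀ : 0 ≤ M₀ := (norm_nonneg _).trans (h₀ 0 (by norm_num))
  have hM₂ : 0 ≤ M₂ := by
    have := (norm_nonneg _).trans (h₂ (1 / 2) (by norm_num) 0 (by norm_num) le_rfl)
    exact nonneg_of_mul_nonneg_left this (by positivity)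
  have hbound : ∀ s ∈ Icc (-1 : ℝ) 0, ‖u s‖ ≤ 3 * M₀ + M₂ := by
    intro s hs
    rcases hs.1.eq_or_lt with rfl | hs1
    · have h := h₂ (1 / 2) (by norm_num) 0 (by norm_num) le_rfl
      have hpow : ((1 : ℝ) / 2) ^ β ≤ 1 :=
        Real.rpow_le_one (by norm_num) (by norm_num) hβ.1.le
      have hle := h.trans (mul_le_of_le_one_right hM₂ hpow)
      norm_num only at hle
      have hu0 := h₀ 0 (by norm_num)
      have huh := h₀ (-1 / 2) (by norm_num)
      calc ‖u (-1)‖ = ‖(u 0 - (2 : ℝ) • u (-1 / 2) + u (-1)) - u 0 + (2 : ℝ) • u (-1 / 2)‖ := by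
            congr 1
            module
        _ ≤ ‖u 0 - (2 : ℝ) • u (-1 / 2) + u (-1)‖ + ‖u 0‖ + ‖(2 : ℝ) • u (-1 / 2)‖ :=
            (norm_add_le _ _).trans (add_le_add_left (norm_sub_le _ _) _)
        _ ≤ 3 * M₀ + M₂ := by
            rw [norm_smul, Real.norm_ofNat]
            linarith
    · linarith [h₀ s ⟨hs1, hs.2⟩]
  refine norm_sub_le_rpow_of_second_difference_le hβ.2.le hbound h₂ ?_ ?_ hτ ht ht0
  · have : 0 ≤ 1 / (2 - (2 : ℝ) ^ β) * (M₀ + M₂) := by positivity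
    linarith
  · have : (18 + 1 / (2 - (2 : ℝ) ^ β)) * (M₀ + M₂) * (2 - 2 ^ β) =
        18 * (M₀ + M₂) * (2 - 2 ^ β) + (M₀ + M₂) := by
      field_simp
    rw [this]
    have : 0 ≤ 18 * (M₀ + M₂) * (2 - (2 : ℝ) ^ β) := by positivity
    linarith
end
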